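/- arXiv:1005.5616 — 4 statements merged into one kernel-verified Lean document; each statement's English description precedes it below -/
import Mathlib

section
/- Let A be a noetherian ring, I an ideal of A, and assume A is I-adically complete. Let A⟨T₁,…,T_m⟩ denote the I-adic completion of the polynomial ring A[T₁,…,T_m], let f₁,…,f_m ∈ A⟨T₁,…,T_m⟩, and put B = A⟨T₁,…,T_m⟩/(f₁,…,f_m). If the image in B of the Jacobian determinant Δ = det(∂fᵢ/∂Tⱼ) is invertible, then there exists an étale A-algebra C whose I-adic completion is isomorphic to B as an A-algebra. -/
open MvPolynomial Topology

/-- `A⟨T₁,…,T_m⟩`: the `I`-adic completion of the polynomial ring `A[T₁,…,T_m]`,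
i.e. the completion with respect to the ideal generated by `I`. -/
noncomputable abbrev RestrictedPowerSeries (A : Type*) [CommRing A] (I : Ideal A) (m : ℕ) :=
  AdicCompletion (I.map (algebraMap A (MvPolynomial (Fin m) A))) (MvPolynomial (Fin m) A)

/-- The canonical ring homomorphism `A[T₁,…,T_m] → A⟨T₁,…,T_m⟩`. -/
noncomputable abbrev RestrictedPowerSeries.of (A : Type*) [CommRing A] (I : Ideal A) (m : ℕ) :
    MvPolynomial (Fin m) A →+* RestrictedPowerSeries A I m :=
  algebraMap _ _

/-- The natural adic topology on `A⟨T₁,…,T_m⟩`, namely the adic topology of the ideal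
generated by (the image of) `I`. -/
noncomputable abbrev RestrictedPowerSeries.topology (A : Type*) [CommRing A] (I : Ideal A)
    (m : ℕ) : TopologicalSpace (RestrictedPowerSeries A I m) :=
  (Ideal.map (RestrictedPowerSeries.of A I m)
    (I.map (algebraMap A (MvPolynomial (Fin m) A)))).adicTopology

theorem Ideal.mem_smul_top_pi {R ι : Type*} [CommRing R] [Finite ι] (I : Ideal R) (x : ι → R) :
    x ∈ (I • ⊤ : Submodule R (ι → R)) ↔ ∀ i, x i ∈ I := by
  classical
  cases nonempty_fintype ι
  refine ⟨fun h i => ?_, fun h => ?_⟩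
  · have := Submodule.mem_map_of_mem (f := LinearMap.proj (R := R) (φ := fun _ : ι => R) i) h
    rw [Submodule.map_smul''] at this
    simpa using Submodule.smul_mono le_rfl le_top this
  · rw [pi_eq_sum_univ' x]
    exact Submodule.sum_mem _ fun i _ => Submodule.smul_mem_smul (h i) trivial

instance IsPrecomplete.pi {R ι : Type*} [CommRing R] [Finite ι] (I : Ideal R) [IsPrecomplete I R] :
    IsPrecomplete I (ι → R) where
  prec' f hf := by
    have key (i : ι) : ∃ L, ∀ n, f n i ≡ L [SMOD (I ^ n • ⊤ : Submodule R R)] := by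
      refine IsPrecomplete.prec' (fun n => f n i) fun {m n} h => ?_
      have := hf h
      rw [SModEq.sub_mem, Ideal.mem_smul_top_pi] at this
      rw [SModEq.sub_mem]
      simpa using this i
    choose L hL using key
    refine ⟨L, fun n => ?_⟩
    rw [SModEq.sub_mem, Ideal.mem_smul_top_pi]
    intro i
    simpa [SModEq.sub_mem] using hL i n

theorem IsHausdorff.submodule {R M : Type*} [CommRing R] [AddCommGroup M] [Module R M]
    (I : Ideal R) [IsHausdorff I M] (N : Submodule R M) : IsHausdorff I N where
  haus' x hx := by
    refine Subtype.ext (IsHausdorff.haus' (I := I) (x : M) fun n => ?_)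
    have := hx n
    rw [SModEq.zero] at this ⊢
    have h := Submodule.mem_map_of_mem (f := N.subtype) this
    rw [Submodule.map_smul''] at h
    exact Submodule.smul_mono le_rfl le_top h

/-- A finitely generated ideal `K` of an `I`-adically complete ring is determined inside a larger
ideal `N` by `N ≤ K + I N`. -/
theorem Ideal.eq_span_range_of_le_sup_mul {R ι : Type*} [CommRing R] [Finite ι] (I : Ideal R)
    [IsAdicComplete I R] (f : ι → R) (N : Ideal R) (hf : ∀ i, f i ∈ N)
    (hN : N ≤ Ideal.span (Set.range f) ⊔ I * N) : N = Ideal.span (Set.range f) := by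
  classical
  cases nonempty_fintype ι
  have : IsHausdorff I N := IsHausdorff.submodule I N
  let φ : (ι → R) →ₗ[R] N := Fintype.linearCombination R fun i => (⟨f i, hf i⟩ : N)
  have hφ (c : ι → R) : (φ c : R) = ∑ i, c i * f i := by
    simp [φ, Fintype.linearCombination_apply]
  have hs : Function.Surjective φ := by
    refine surjective_of_mkQ_comp_surjective (I := I) fun y => ?_
    obtain ⟨y, rfl⟩ := Submodule.mkQ_surjective _ y
    obtain ⟨a, ha, b, hb, hab⟩ := Submodule.mem_sup.mp (hN y.2)
    obtain ⟨c, hc⟩ := (Ideal.mem_span_range_iff_exists_fun).mp ha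
    refine ⟨c, ?_⟩
    rw [LinearMap.comp_apply, ← sub_eq_zero, ← map_sub, ← LinearMap.mem_ker, Submodule.ker_mkQ,
      ← neg_mem_iff]
    have h1 : ((-(φ c - y) : N) : R) = b := by
      simp [hφ, hc, ← hab]
    rw [← Submodule.map_subtype_top N, ] at hb
    rw [← smul_eq_mul, ← Submodule.map_smul''] at hb
    obtain ⟨z, hz, hzb⟩ := hb
    rwa [show -(φ c - y) = z from Subtype.ext (h1.trans hzb.symm)]
  refine le_antisymm (fun y hy => ?_) (Ideal.span_le.mpr (by rintro _ ⟨i, rfl⟩; exact hf i))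
  obtain ⟨c, hc⟩ := hs ⟨y, hy⟩
  exact Ideal.mem_span_range_iff_exists_fun.mpr ⟨c, by rw [← hφ, hc]⟩

/-- If the target of `φ` is flat, then `ker φ ∩ I R = I ker φ`. -/
theorem AlgHom.ker_inf_map_le_of_flat {A R S : Type*} [CommRing A] [CommRing R] [CommRing S]
    [Algebra A R] [Algebra A S] [Module.Flat A S] (I : Ideal A) (φ : R →ₐ[A] S)
    (hφ : Function.Surjective φ) :
    RingHom.ker φ ⊓ I.map (algebraMap A R) ≤ I.map (algebraMap A R) * RingHom.ker φ := by
  rintro x ⟨hx, hxI⟩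
  obtain ⟨n, a, p, rfl⟩ : ∃ (n : ℕ) (a : Fin n → I) (p : Fin n → R),
      ∑ k, algebraMap A R (a k) * p k = x := by
    rw [Ideal.map, SetLike.mem_coe, Submodule.mem_span_set'] at hxI
    obtain ⟨n, p, g, rfl⟩ := hxI
    choose a ha hag using fun i => (g i).2
    exact ⟨n, fun i => ⟨a i, ha i⟩, p, by simp [hag, mul_comm]⟩
  have h0 : ∑ k, (a k : A) • φ (p k) = 0 := by
    simpa [RingHom.mem_ker, Algebra.smul_def] using hx
  obtain ⟨κ, c, q, hq, hc⟩ :=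
    Module.Flat.isTrivialRelation_of_sum_smul_eq_zero (R := A) (M := S)
      (f := fun k => (a k : A)) (x := fun k => φ (p k)) h0
  choose r hr using fun j => hφ (q j)
  have h1 : ∑ k, algebraMap A R (a k) * p k =
      ∑ k, algebraMap A R (a k) * (p k - ∑ j, c k j • r j) := by
    simp only [mul_sub, Finset.sum_sub_distrib, Finset.mul_sum, Algebra.smul_def, ← mul_assoc,
      ← map_mul]
    rw [Finset.sum_comm (s := Finset.univ (α := Fin n))]
    simp only [← Finset.sum_mul, ← map_sum, hc]
    simp
  rw [h1]
  refine Ideal.sum_mem _ fun k _ => Ideal.mul_mem_mul (Ideal.mem_map_of_mem _ (a k).2) ?_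
  simp [RingHom.mem_ker, hq, hr]

/-- Completed Nakayama-type criterion: a map to a flat complete algebra, surjective modulo `I` with
kernel generated modulo `I` by elements of the kernel, is the quotient by these elements. -/
theorem AlgHom.surjective_and_ker_eq_span {A R S ι : Type*} [CommRing A] [CommRing R] [CommRing S]
    [Algebra A R] [Algebra A S] [Module.Flat A S] [_root_.Finite ι] (I : Ideal A)
    [IsAdicComplete I R] [IsHausdorff I S] (φ : R →ₐ[A] S) (f : ι → R) (hf : ∀ i, φ (f i) = 0)
    (hs : ∀ y, ∃ x, φ x - y ∈ I.map (algebraMap A S))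
    (hk : ∀ x, φ x ∈ I.map (algebraMap A S) →
      x ∈ Ideal.span (Set.range f) ⊔ I.map (algebraMap A R)) :
    Function.Surjective φ ∧ RingHom.ker φ = Ideal.span (Set.range f) := by
  have hsurj : Function.Surjective φ.toLinearMap := by
    refine surjective_of_mkQ_comp_surjective (I := I) fun y => ?_
    obtain ⟨y, rfl⟩ := Submodule.mkQ_surjective _ y
    obtain ⟨x, hx⟩ := hs y
    refine ⟨x, ?_⟩
    rw [LinearMap.comp_apply, ← sub_eq_zero, ← map_sub, ← LinearMap.mem_ker, Submodule.ker_mkQ,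
      Ideal.smul_top_eq_map]
    exact hx
  have : IsAdicComplete (I.map (algebraMap A R)) R :=
    (IsAdicComplete.map_algebraMap_iff _ _).mpr inferInstance
  refine ⟨hsurj, Ideal.eq_span_range_of_le_sup_mul (I.map (algebraMap A R)) f _
    (fun i => hf i) fun x hx => ?_⟩
  obtain ⟨a, ha, b, hb, rfl⟩ := Submodule.mem_sup.mp (hk x (by
    rw [RingHom.mem_ker] at hx; rw [hx]; exact zero_mem _))
  have ha' : a ∈ RingHom.ker φ :=
    Ideal.span_le.mpr (by rintro _ ⟨i, rfl⟩; exact hf i) ha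
  have hb' : b ∈ RingHom.ker φ := by simpa using sub_mem hx ha'
  exact Submodule.add_mem_sup ha (AlgHom.ker_inf_map_le_of_flat I φ hsurj ⟨hb', hb⟩)

open Algebra in
theorem MvPolynomial.etale_localizationAway_det {A ι : Type*} [CommRing A] [Fintype ι]
    [DecidableEq ι] (g : ι → MvPolynomial ι A) :
    Algebra.Etale A (Localization.Away (Ideal.Quotient.mk (Ideal.span (Set.range g))
      (Matrix.of fun i j => pderiv j (g i)).det)) := by
  set D := Ideal.Quotient.mk (Ideal.span (Set.range g)) (Matrix.of fun i j => pderiv j (g i)).det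
    with hD
  let P₁ : PreSubmersivePresentation A (MvPolynomial ι A ⧸ Ideal.span (Set.range g)) ι ι :=
    PreSubmersivePresentation.naive id Function.injective_id
  let P₂ := SubmersivePresentation.localizationAway (Localization.Away D) D
  have h₁ : P₁.jacobian = D := by
    rw [PreSubmersivePresentation.jacobian_eq_jacobiMatrix_det]
    have : P₁.jacobiMatrix = (Matrix.of fun i j => pderiv j (g i)).transpose := by
      ext1 i j
      simp [P₁]
    rw [this, Matrix.det_transpose]
    rfl
  let Q : SubmersivePresentation A (Localization.Away D) (Unit ⊕ ι) (Unit ⊕ ι) :=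
    { P₂.toPreSubmersivePresentation.comp P₁ with
      jacobian_isUnit := by
        have := PreSubmersivePresentation.comp_jacobian_eq_jacobian_smul_jacobian
          P₂.toPreSubmersivePresentation P₁
        rw [this, Algebra.smul_def, h₁]
        exact (IsLocalization.Away.algebraMap_isUnit D).mul P₂.jacobian_isUnit }
  have : IsStandardSmoothOfRelativeDimension 0 A (Localization.Away D) :=
    Q.isStandardSmoothOfRelativeDimension (by simp [Presentation.dimension])
  infer_instance

theorem MvPolynomial.exists_etale_of_det_mul_sub_one_mem {A : Type u} {ι : Type v} [CommRing A]
    [Fintype ι]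
    [DecidableEq ι] (I : Ideal A) (g : ι → MvPolynomial ι A) (d : MvPolynomial ι A)
    (hd : (Matrix.of fun i j => pderiv j (g i)).det * d - 1 ∈
      Ideal.span (Set.range g) ⊔ I.map (algebraMap A (MvPolynomial ι A))) :
    ∃ (C : Type max u v) (_ : CommRing C) (_ : Algebra A C) (π : MvPolynomial ι A →ₐ[A] C),
      Algebra.Etale A C ∧ (∀ i, π (g i) = 0) ∧
      (∀ c, ∃ p, π p - c ∈ I.map (algebraMap A C)) ∧
      (∀ p, π p ∈ I.map (algebraMap A C) →
        p ∈ Ideal.span (Set.range g) ⊔ I.map (algebraMap A (MvPolynomial ι A))) := by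
  set K := Ideal.span (Set.range g) ⊔ I.map (algebraMap A (MvPolynomial ι A)) with hK
  set D := (Matrix.of fun i j => pderiv j (g i)).det
  set Q := MvPolynomial ι A ⧸ Ideal.span (Set.range g)
  set D' : Q := Ideal.Quotient.mk _ D with hD'
  let π : MvPolynomial ι A →ₐ[A] Localization.Away D' :=
    (IsScalarTower.toAlgHom A Q (Localization.Away D')).comp (Ideal.Quotient.mkₐ A _)
  have hπ (p) : π p = algebraMap Q _ (Ideal.Quotient.mk _ p) := rfl
  have hpow (n : ℕ) : (D * d) ^ n - 1 ∈ K := by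
    rw [← Ideal.Quotient.eq] at hd ⊢
    rw [map_pow, hd, map_one, one_pow]
  have hg (i) : π (g i) = 0 := by
    rw [hπ, Ideal.Quotient.eq_zero_iff_mem.mpr (Ideal.subset_span (Set.mem_range_self i)), map_zero]
  have hπK {p} (hp : p ∈ K) : π p ∈ I.map (algebraMap A (Localization.Away D')) := by
    have : K ≤ (I.map (algebraMap A (Localization.Away D'))).comap π := by
      refine sup_le (Ideal.span_le.mpr ?_) (Ideal.map_le_iff_le_comap.mpr fun a ha => ?_)
      · rintro _ ⟨i, rfl⟩
        simp [hg]
      · simpa using Ideal.mem_map_of_mem (algebraMap A (Localization.Away D')) ha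
    exact this hp
  refine ⟨Localization.Away D', inferInstance, inferInstance, π,
    MvPolynomial.etale_localizationAway_det g, hg, fun c => ?_, fun p hp => ?_⟩
  · obtain ⟨n, a, ha⟩ := IsLocalization.Away.surj D' c
    obtain ⟨q, rfl⟩ := Ideal.Quotient.mk_surjective a
    refine ⟨q * d ^ n, ?_⟩
    have h1 : π (q * d ^ n) - c = c * π ((D * d) ^ n - 1) := by
      have : π q = c * π D ^ n := by rw [hπ q, hπ D, ← ha]
      simp only [map_mul, map_sub, map_pow, map_one, this]
      ring
    rw [h1]
    exact Ideal.mul_mem_left _ _ (hπK (hpow n))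
  · rw [IsScalarTower.algebraMap_eq A Q, ← Ideal.map_map, hπ,
      IsLocalization.algebraMap_mem_map_algebraMap_iff (Submonoid.powers D')] at hp
    obtain ⟨_, ⟨n, rfl⟩, hn⟩ := hp
    have hn' : D ^ n * p ∈ K := by
      rw [IsScalarTower.algebraMap_eq A (MvPolynomial ι A) Q, ← Ideal.map_map,
        show D' ^ n * Ideal.Quotient.mk _ p = Ideal.Quotient.mk _ (D ^ n * p) by
          simp [hD'], Ideal.Quotient.algebraMap_eq, ← Ideal.mem_comap,
        Ideal.comap_map_of_surjective' _ Ideal.Quotient.mk_surjective, Ideal.mk_ker, sup_comm] at hn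
      exact hn
    have : p = d ^ n * (D ^ n * p) - p * ((D * d) ^ n - 1) := by ring
    rw [this]
    exact sub_mem (Ideal.mul_mem_left _ _ hn') (Ideal.mul_mem_left _ _ (hpow n))

theorem MvPolynomial.aeval_add_sub_mem_sq {A C ι : Type*} [CommRing A] [CommRing C] [Algebra A C]
    [Fintype ι] (𝔞 : Ideal C) (t h : ι → C) (hh : ∀ j, h j ∈ 𝔞) (p : MvPolynomial ι A) :
    aeval (t + h) p - aeval t p - ∑ j, aeval t (pderiv j p) * h j ∈ 𝔞 ^ 2 := by
  classical
  induction p using MvPolynomial.induction_on with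
  | C a => simp
  | add p q hp hq =>
    convert add_mem hp hq using 1
    simp only [map_add, add_mul, Finset.sum_add_distrib]
    ring
  | mul_X p i hp =>
    set e := aeval (t + h) p - aeval t p - ∑ j, aeval t (pderiv j p) * h j with he
    have h1 : (∑ j, aeval t (pderiv j p) * h j) * h i ∈ 𝔞 ^ 2 := by
      rw [pow_two]
      exact Ideal.mul_mem_mul (Ideal.sum_mem _ fun j _ => Ideal.mul_mem_left _ _ (hh j)) (hh i)
    convert add_mem (Ideal.mul_mem_right (t i + h i) _ hp) h1 using 1
    have h2 : ∑ j, aeval t (pderiv j (p * X i)) * h j =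
        (∑ j, aeval t (pderiv j p) * h j) * t i + aeval t p * h i := by
      simp only [Derivation.leibniz, pderiv_X, smul_eq_mul, map_add, map_mul, add_mul,
        Finset.sum_add_distrib, aeval_X, Finset.sum_mul]
      rw [add_comm]
      congr 1
      · exact Finset.sum_congr rfl fun j _ => by ring
      · rw [Finset.sum_eq_single i (fun j _ hj => by simp [hj.symm]) (by simp)]
        simp
    rw [h2, he]
    simp only [map_mul, aeval_X, Pi.add_apply]
    ring

/-- One step of Newton's method for a square system of polynomial equations. -/
theorem MvPolynomial.exists_newton_step {A C ι : Type*} [CommRing A] [CommRing C] [Algebra A C]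
    [Fintype ι] [DecidableEq ι] {𝔞 𝔠 : Ideal C} (h𝔞 : 𝔞 ≤ 𝔠) (q : ι → MvPolynomial ι A)
    (t : ι → C) (hq : ∀ i, aeval t (q i) ∈ 𝔞) (u : C)
    (hu : aeval t (Matrix.of fun i j => pderiv j (q i)).det * u - 1 ∈ 𝔠) :
    ∃ t' : ι → C, (∀ j, t' j - t j ∈ 𝔞) ∧ ∀ i, aeval t' (q i) ∈ 𝔠 * 𝔞 := by
  set M : Matrix ι ι C := Matrix.of fun i j => aeval t (pderiv j (q i)) with hM
  have hdet : aeval t (Matrix.of fun i j => pderiv j (q i)).det = M.det := by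
    rw [AlgHom.map_det]
    rfl
  set v : ι → C := fun i => aeval t (q i)
  let h : ι → C := (-u) • (M.adjugate.mulVec v)
  have hh (j) : h j ∈ 𝔞 := Ideal.mul_mem_left _ _ (Ideal.sum_mem _ fun i _ =>
    Ideal.mul_mem_left _ _ (hq i))
  have hMh : M.mulVec h = (-u * M.det) • v := by
    simp only [h, Matrix.mulVec_smul, Matrix.mulVec_mulVec, Matrix.mul_adjugate,
      Matrix.smul_mulVec, Matrix.one_mulVec, smul_smul]
  refine ⟨t + h, fun j => by simpa using hh j, fun i => ?_⟩
  have h1 := aeval_add_sub_mem_sq 𝔞 t h hh (q i)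
  have h2 : ∑ j, aeval t (pderiv j (q i)) * h j = -u * M.det * v i := congrFun hMh i
  rw [hdet] at hu
  have h3 : aeval (t + h) (q i) = (aeval (t + h) (q i) - aeval t (q i) -
      ∑ j, aeval t (pderiv j (q i)) * h j) - (M.det * u - 1) * v i := by
    rw [h2]
    ring
  rw [h3]
  refine sub_mem ?_ (Ideal.mul_mem_mul hu (hq i))
  rw [pow_two] at h1
  exact Ideal.mul_mono_left h𝔞 h1

theorem MvPolynomial.pderiv_mem_map_algebraMap {A ι : Type*} [CommRing A] (I : Ideal A)
    {p : MvPolynomial ι A} (hp : p ∈ I.map (algebraMap A (MvPolynomial ι A))) (j : ι) :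
    pderiv j p ∈ I.map (algebraMap A (MvPolynomial ι A)) := by
  induction hp using Submodule.span_induction with
  | mem x hx =>
    obtain ⟨a, -, rfl⟩ := hx
    simp [algebraMap_eq]
  | zero => simp
  | add x y _ _ hx hy => simpa using add_mem hx hy
  | smul a x hx hx' =>
    rw [smul_eq_mul, Derivation.leibniz, smul_eq_mul, smul_eq_mul]
    exact add_mem (Ideal.mul_mem_left _ _ hx') (Ideal.mul_mem_right _ _ hx)

theorem AlgHom.apply_mem_map_pow {A R S : Type*} [CommRing A] [CommRing R] [CommRing S]
    [Algebra A R] [Algebra A S] (φ : R →ₐ[A] S) (I : Ideal A) {n : ℕ} {x : R}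
    (hx : x ∈ I.map (algebraMap A R) ^ n) : φ x ∈ I.map (algebraMap A S) ^ n := by
  rw [← Ideal.map_pow] at hx ⊢
  have : (I ^ n).map (algebraMap A R) ≤ ((I ^ n).map (algebraMap A S)).comap φ :=
    Ideal.map_le_iff_le_comap.mpr fun a ha => by
      simpa using Ideal.mem_map_of_mem (algebraMap A S) ha
  exact this hx

theorem MvPolynomial.mk_aeval_eq_mk_aeval {A C ι : Type*} [CommRing A] [CommRing C] [Algebra A C]
    {𝔠 : Ideal C} {s t : ι → C} (h : ∀ j, t j - s j ∈ 𝔠) (p : MvPolynomial ι A) :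
    Ideal.Quotient.mk 𝔠 (aeval t p) = Ideal.Quotient.mk 𝔠 (aeval s p) := by
  have : (Ideal.Quotient.mkₐ A 𝔠).comp (aeval t) = (Ideal.Quotient.mkₐ A 𝔠).comp (aeval s) := by
    ext j
    simpa using Ideal.Quotient.eq.mpr (h j)
  exact DFunLike.congr_fun this p

theorem MvPolynomial.map_det_pderiv_eq {A ι R : Type*} [CommRing A] [CommRing R] [Fintype ι]
    [DecidableEq ι] (I : Ideal A) (ρ : MvPolynomial ι A →+* R)
    (hρ : ∀ x ∈ I.map (algebraMap A (MvPolynomial ι A)), ρ x = 0) {p q : ι → MvPolynomial ι A}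
    (hpq : ∀ i, p i - q i ∈ I.map (algebraMap A (MvPolynomial ι A))) :
    ρ (Matrix.of fun i j => pderiv j (p i)).det = ρ (Matrix.of fun i j => pderiv j (q i)).det := by
  rw [RingHom.map_det, RingHom.map_det]
  congr 1
  ext i j
  have := hρ _ (pderiv_mem_map_algebraMap I (hpq i) j)
  rwa [map_sub, map_sub, sub_eq_zero] at this

/-- Newton's method for a sequence of systems of equations that converges `I`-adically. -/
theorem MvPolynomial.exists_newton_seq {A C ι : Type*} [CommRing A] [CommRing C] [Algebra A C]
    [Fintype ι] [DecidableEq ι] (I : Ideal A) (p : ℕ → ι → MvPolynomial ι A)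
    (hp : ∀ n i, p (n + 1) i - p n i ∈ I.map (algebraMap A (MvPolynomial ι A)) ^ n)
    (s : ι → C) (hs : ∀ i, aeval s (p 1 i) = 0) (u : C)
    (hu : aeval s (Matrix.of fun i j => pderiv j (p 1 i)).det * u - 1 ∈ I.map (algebraMap A C)) :
    ∃ t : ℕ → ι → C, (∀ n j, t n j - s j ∈ I.map (algebraMap A C)) ∧
      (∀ n j, t (n + 1) j - t n j ∈ I.map (algebraMap A C) ^ (n + 1)) ∧
      ∀ n i, aeval (t n) (p (n + 1) i) ∈ I.map (algebraMap A C) ^ (n + 1) := by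
  set 𝔠 := I.map (algebraMap A C) with h𝔠
  have hp1 (n : ℕ) (i) : p (n + 1) i - p 1 i ∈ I.map (algebraMap A (MvPolynomial ι A)) := by
    induction n with
    | zero => simp
    | succ n ih =>
      simpa using add_mem (Ideal.pow_le_self n.succ_ne_zero (hp (n + 1) i)) ih
  have step (n : ℕ) (t : ι → C) (h1 : ∀ j, t j - s j ∈ 𝔠)
      (h2 : ∀ i, aeval t (p (n + 1) i) ∈ 𝔠 ^ (n + 1)) :
      ∃ t' : ι → C, (∀ j, t' j - t j ∈ 𝔠 ^ (n + 1)) ∧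
        ∀ i, aeval t' (p (n + 1 + 1) i) ∈ 𝔠 ^ (n + 1 + 1) := by
    have h3 (i) : aeval t (p (n + 1 + 1) i) ∈ 𝔠 ^ (n + 1) := by
      simpa using add_mem (AlgHom.apply_mem_map_pow (aeval t) I (hp (n + 1) i)) (h2 i)
    rw [pow_succ' 𝔠 (n + 1)]
    refine exists_newton_step (Ideal.pow_le_self n.succ_ne_zero) _ t h3 u ?_
    rw [← Ideal.Quotient.eq] at hu ⊢
    rw [map_mul] at hu ⊢
    rw [mk_aeval_eq_mk_aeval h1, ← hu]
    congr 1
    refine map_det_pderiv_eq I ((Ideal.Quotient.mk 𝔠).comp (aeval s : _ →ₐ[A] C).toRingHom)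
      (fun x hx => ?_) (hp1 (n + 1))
    rw [RingHom.comp_apply, Ideal.Quotient.eq_zero_iff_mem]
    simpa using AlgHom.apply_mem_map_pow (aeval s : _ →ₐ[A] C) I (n := 1) (by simpa using hx)
  let T (n : ℕ) := {t : ι → C // (∀ j, t j - s j ∈ 𝔠) ∧
    ∀ i, aeval t (p (n + 1) i) ∈ 𝔠 ^ (n + 1)}
  choose next hn1 hn2 using step
  let seq (n : ℕ) : T n := Nat.rec ⟨s, by simp, by simp [hs]⟩ (fun n t =>
    ⟨next n t.1 t.2.1 t.2.2, fun j => by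
      simpa using add_mem (Ideal.pow_le_self n.succ_ne_zero (hn1 n t.1 t.2.1 t.2.2 j)) (t.2.1 j),
      hn2 n t.1 t.2.1 t.2.2⟩) n
  exact ⟨fun n => (seq n).1, fun n => (seq n).2.1, fun n => hn1 n _ (seq n).2.1 (seq n).2.2,
    fun n => (seq n).2.2⟩

theorem AdicCompletion.evalₐ_eq_zero_iff {R : Type*} [CommRing R] {J : Ideal R} (hJ : J.FG)
    (n : ℕ) (x : AdicCompletion J R) :
    AdicCompletion.evalₐ J n x = 0 ↔ x ∈ J.map (algebraMap R (AdicCompletion J R)) ^ n := by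
  have h : AdicCompletion.evalₐ J n x = 0 ↔ x ∈ (AdicCompletion.eval J R n).ker :=
    EmbeddingLike.map_eq_zero_iff (f := Ideal.quotientEquivAlgOfEq R
      (show (J ^ n • ⊤ : Ideal R) = J ^ n by simp))
  rw [h, ← AdicCompletion.pow_smul_top_eq_ker_eval hJ, Ideal.smul_top_eq_map, Ideal.map_pow]
  rfl

theorem AdicCompletion.mem_map_algebraMap_iff {A C : Type*} [CommRing A] [CommRing C] [Algebra A C]
    {I : Ideal A} (hI : I.FG) (x : AdicCompletion (I.map (algebraMap A C)) C) :
    x ∈ I.map (algebraMap A (AdicCompletion (I.map (algebraMap A C)) C)) ↔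
      AdicCompletion.evalₐ (I.map (algebraMap A C)) 1 x = 0 := by
  rw [evalₐ_eq_zero_iff (hI.map _), pow_one, Ideal.map_map, ← IsScalarTower.algebraMap_eq]

theorem AdicCompletion.mk_sub_mem_pow {R : Type*} [CommRing R] {J : Ideal R}
    (x : AdicCompletion J R) {m n : ℕ} (hmn : m ≤ n) {p q : R}
    (hp : AdicCompletion.evalₐ J m x = Ideal.Quotient.mk _ p)
    (hq : AdicCompletion.evalₐ J n x = Ideal.Quotient.mk _ q) : q - p ∈ J ^ m := by
  obtain ⟨s, rfl⟩ := AdicCompletion.mk_surjective J R x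
  rw [AdicCompletion.evalₐ_mk, Ideal.Quotient.eq] at hp hq
  have hs : s.val m - s.val n ∈ J ^ m := by
    simpa using SModEq.sub_mem.mp (s.property hmn)
  convert sub_mem (sub_mem hp hs) (Ideal.pow_le_pow_right hmn hq) using 1
  ring

open AdicCompletion in
/-- A sequence of algebra maps which is Cauchy for the adic topologies induces a map of adic
completions. -/
theorem AdicCompletion.exists_algHom_of_cauchySeq {A P C : Type*} [CommRing A] [CommRing P]
    [CommRing C] [Algebra A P] [Algebra A C] (J : Ideal P) (K : Ideal C) (φ : ℕ → P →ₐ[A] C)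
    (hJ : ∀ n, J ^ n ≤ (K ^ n).comap (φ n)) (hφ : ∀ {m n}, m ≤ n → ∀ p, φ n p - φ m p ∈ K ^ m) :
    ∃ Φ : AdicCompletion J P →ₐ[A] AdicCompletion K C,
      ∀ n x p, evalₐ J n x = Ideal.Quotient.mk _ p →
        evalₐ K n (Φ x) = Ideal.Quotient.mk _ (φ n p) := by
  let ψ (n : ℕ) : AdicCompletion J P →ₐ[A] C ⧸ K ^ n :=
    (Ideal.quotientMapₐ (K ^ n) (φ n) (hJ n)).comp ((evalₐ J n).restrictScalars A)
  have hψ (n x p) (h : evalₐ J n x = Ideal.Quotient.mk _ p) :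
      ψ n x = Ideal.Quotient.mk _ (φ n p) :=
    congrArg (Ideal.quotientMapₐ (K ^ n) (φ n) (hJ n)) h
  refine ⟨liftAlgHom K ψ fun {m n} hmn => ?_, fun n x p h => ?_⟩
  · ext x
    obtain ⟨p, hp⟩ := Ideal.Quotient.mk_surjective (evalₐ J n x)
    have hpm : evalₐ J m x = Ideal.Quotient.mk _ p := by
      obtain ⟨q, hq⟩ := Ideal.Quotient.mk_surjective (evalₐ J m x)
      rw [← hq, eq_comm, Ideal.Quotient.eq]
      exact mk_sub_mem_pow x hmn hq.symm hp.symm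
    rw [AlgHom.comp_apply, hψ n x p hp.symm, hψ m x p hpm, ← Ideal.Quotient.eq.mpr (hφ hmn p)]
    rfl
  · rw [evalₐ_liftAlgHom, hψ n x p h]

open AdicCompletion in
/-- A coordinatewise Cauchy sequence of points of `C` defines an evaluation map on restricted power
series. -/
theorem MvPolynomial.exists_algHom_adicCompletion {A C ι : Type*} [CommRing A] [CommRing C]
    [Algebra A C] (I : Ideal A) (t : ℕ → ι → C)
    (ht : ∀ n j, t (n + 1) j - t n j ∈ I.map (algebraMap A C) ^ (n + 1)) :
    ∃ Φ : AdicCompletion (I.map (algebraMap A (MvPolynomial ι A))) (MvPolynomial ι A) →ₐ[A]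
        AdicCompletion (I.map (algebraMap A C)) C,
      ∀ n x p, evalₐ _ n x = Ideal.Quotient.mk _ p →
        evalₐ _ n (Φ x) = Ideal.Quotient.mk _ (aeval (t n) p) := by
  have ht' {m n : ℕ} (hmn : m ≤ n) (j) : t n j - t m j ∈ I.map (algebraMap A C) ^ m := by
    induction n, hmn using Nat.le_induction with
    | base => simp
    | succ n hmn ih =>
      simpa using add_mem (Ideal.pow_le_pow_right (hmn.trans n.le_succ) (ht n j)) ih
  exact exists_algHom_of_cauchySeq _ _ (fun n => aeval (t n))
    (fun n _ hx => AlgHom.apply_mem_map_pow (aeval (t n)) I hx)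
    fun hmn p => Ideal.Quotient.eq.mp (mk_aeval_eq_mk_aeval (ht' hmn) p)

open AdicCompletion in
theorem AdicCompletion.surjective_and_ker_eq_span {A P C ι : Type*} [CommRing A] [CommRing P]
    [CommRing C] [Algebra A P] [Algebra A C] [IsNoetherianRing C] [Module.Flat A C] [Finite ι]
    {I : Ideal A} (hI : I.FG) (π : P →ₐ[A] C)
    (Φ : AdicCompletion (I.map (algebraMap A P)) P →ₐ[A] AdicCompletion (I.map (algebraMap A C)) C)
    (hΦ : ∀ x p, evalₐ _ 1 x = Ideal.Quotient.mk _ p → evalₐ _ 1 (Φ x) = Ideal.Quotient.mk _ (π p))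
    {f : ι → AdicCompletion (I.map (algebraMap A P)) P} {g : ι → P}
    (hfg : ∀ i, evalₐ _ 1 (f i) = Ideal.Quotient.mk _ (g i)) (hf : ∀ i, Φ (f i) = 0)
    (hπs : ∀ c, ∃ p, π p - c ∈ I.map (algebraMap A C))
    (hπk : ∀ p, π p ∈ I.map (algebraMap A C) →
      p ∈ Ideal.span (Set.range g) ⊔ I.map (algebraMap A P)) :
    Function.Surjective Φ ∧ RingHom.ker Φ = Ideal.span (Set.range f) := by
  have hof (n : ℕ) (p) : evalₐ (I.map (algebraMap A P)) n (algebraMap P _ p) =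
      Ideal.Quotient.mk _ p := AlgHom.commutes _ p
  have : Module.Flat A (AdicCompletion (I.map (algebraMap A C)) C) := Module.Flat.trans A C _
  have : IsAdicComplete I (AdicCompletion (I.map (algebraMap A P)) P) :=
    (IsAdicComplete.map_algebraMap_iff I _).mp (AdicCompletion.isAdicComplete (hI.map _))
  have : IsHausdorff I (AdicCompletion (I.map (algebraMap A C)) C) :=
    (IsHausdorff.map_algebraMap_iff (S := C)).mp inferInstance
  refine AlgHom.surjective_and_ker_eq_span I Φ f hf (fun y => ?_) fun x hx => ?_
  · obtain ⟨c, hc⟩ := Ideal.Quotient.mk_surjective (evalₐ (I.map (algebraMap A C)) 1 y)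
    obtain ⟨p, hp⟩ := hπs c
    refine ⟨algebraMap P _ p, ?_⟩
    rw [mem_map_algebraMap_iff hI, map_sub, hΦ _ p (hof 1 p), ← hc, ← map_sub,
      Ideal.Quotient.eq_zero_iff_mem, pow_one]
    exact hp
  · obtain ⟨p, hp⟩ := Ideal.Quotient.mk_surjective (evalₐ (I.map (algebraMap A P)) 1 x)
    rw [mem_map_algebraMap_iff hI, hΦ x p hp.symm, Ideal.Quotient.eq_zero_iff_mem, pow_one] at hx
    set K := Ideal.span (Set.range f) ⊔
      I.map (algebraMap A (AdicCompletion (I.map (algebraMap A P)) P))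
    have hK : Ideal.span (Set.range g) ⊔ I.map (algebraMap A P) ≤ K.comap (algebraMap P _) := by
      refine sup_le (Ideal.span_le.mpr ?_) fun z hz => ?_
      · rintro _ ⟨i, rfl⟩
        have h1 : algebraMap P _ (g i) - f i ∈ K := Ideal.mem_sup_right
          ((mem_map_algebraMap_iff hI _).mpr (by rw [map_sub, hof, hfg, sub_self]))
        have h2 : f i ∈ K := Ideal.mem_sup_left (Ideal.subset_span ⟨i, rfl⟩)
        simpa using add_mem h1 h2
      · refine Ideal.mem_sup_right ((mem_map_algebraMap_iff hI _).mpr ?_)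
        rw [hof, Ideal.Quotient.eq_zero_iff_mem, pow_one]
        exact hz
    have h1 : x - algebraMap P _ p ∈ K := Ideal.mem_sup_right
      ((mem_map_algebraMap_iff hI _).mpr (by rw [map_sub, hof, hp, sub_self]))
    have h2 := add_mem h1 (hK (hπk p hx))
    rwa [sub_add_cancel] at h2

/-- A continuous extension of `∂/∂Tⱼ` is compatible with the partial derivative modulo `I`. -/
theorem RestrictedPowerSeries.evalₐ_one_pd {A : Type*} [CommRing A] {I : Ideal A} (hI : I.FG)
    {m : ℕ} (j : Fin m) (pd : RestrictedPowerSeries A I m → RestrictedPowerSeries A I m)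
    (hcont : Continuous[RestrictedPowerSeries.topology A I m,
      RestrictedPowerSeries.topology A I m] pd)
    (hext : ∀ p : MvPolynomial (Fin m) A,
      pd (RestrictedPowerSeries.of A I m p) = RestrictedPowerSeries.of A I m (pderiv j p))
    (x : RestrictedPowerSeries A I m) (p : MvPolynomial (Fin m) A)
    (hp : AdicCompletion.evalₐ _ 1 x = Ideal.Quotient.mk _ p) :
    AdicCompletion.evalₐ _ 1 (pd x) = Ideal.Quotient.mk _ (pderiv j p) := by
  set J := I.map (algebraMap A (MvPolynomial (Fin m) A))
  set J' := J.map (RestrictedPowerSeries.of A I m) with hJ'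
  have hJfg : J.FG := hI.map _
  have hof (n : ℕ) (q) : AdicCompletion.evalₐ J n (RestrictedPowerSeries.of A I m q) =
      Ideal.Quotient.mk _ q := AdicCompletion.evalₐ_of J n q
  have h1 := (@continuous_iff_continuousAt _ _ (RestrictedPowerSeries.topology A I m)
    (RestrictedPowerSeries.topology A I m) pd).mp hcont x
  have h2 := ((J'.hasBasis_nhds_adic x).tendsto_iff (J'.hasBasis_nhds_adic (pd x))).mp h1 1 trivial
  obtain ⟨N, -, hN⟩ := h2
  obtain ⟨q, hq⟩ := Ideal.Quotient.mk_surjective (AdicCompletion.evalₐ J (N + 1) x)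
  have hqx : RestrictedPowerSeries.of A I m q - x ∈ J' ^ (N + 1) := by
    rw [hJ', ← AdicCompletion.evalₐ_eq_zero_iff hJfg, map_sub, hof, hq, sub_self]
  obtain ⟨z, hz, hzq⟩ := hN (RestrictedPowerSeries.of A I m q)
    ⟨_, Ideal.pow_le_pow_right N.le_succ hqx, by simp⟩
  have h3 : AdicCompletion.evalₐ J 1 z = 0 := (AdicCompletion.evalₐ_eq_zero_iff hJfg 1 z).mpr hz
  have h4 := congrArg (AdicCompletion.evalₐ J 1) hzq
  simp only [map_add, h3, add_zero, hext, hof] at h4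
  rw [h4, Ideal.Quotient.eq, pow_one, ← map_sub]
  have := AdicCompletion.mk_sub_mem_pow x (Nat.le_add_left 1 N) hp hq.symm
  rw [pow_one] at this
  exact pderiv_mem_map_algebraMap I this j

theorem RestrictedPowerSeries.exists_det_mul_sub_one_mem {A : Type*} [CommRing A] {I : Ideal A}
    (hI : I.FG) (m : ℕ)
    (pd : Fin m → RestrictedPowerSeries A I m → RestrictedPowerSeries A I m)
    (hpd_cont : ∀ j : Fin m,
      Continuous[RestrictedPowerSeries.topology A I m, RestrictedPowerSeries.topology A I m]
        (pd j))
    (hpd_ext : ∀ (j : Fin m) (p : MvPolynomial (Fin m) A),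
      pd j (RestrictedPowerSeries.of A I m p) = RestrictedPowerSeries.of A I m (pderiv j p))
    (f : Fin m → RestrictedPowerSeries A I m)
    (hΔ : IsUnit (Ideal.Quotient.mk (Ideal.span (Set.range f))
      (Matrix.det (Matrix.of fun i j : Fin m => pd j (f i)))))
    (g : Fin m → MvPolynomial (Fin m) A)
    (hg : ∀ i, AdicCompletion.evalₐ _ 1 (f i) = Ideal.Quotient.mk _ (g i)) :
    ∃ d, (Matrix.of fun i j => pderiv j (g i)).det * d - 1 ∈
      Ideal.span (Set.range g) ⊔ I.map (algebraMap A (MvPolynomial (Fin m) A)) := by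
  set J := I.map (algebraMap A (MvPolynomial (Fin m) A))
  obtain ⟨y, hy⟩ := hΔ.exists_right_inv
  obtain ⟨y, rfl⟩ := Ideal.Quotient.mk_surjective y
  rw [← map_mul, ← map_one (Ideal.Quotient.mk _), Ideal.Quotient.eq] at hy
  obtain ⟨d, hd⟩ := Ideal.Quotient.mk_surjective (AdicCompletion.evalₐ J 1 y)
  have h1 := Ideal.mem_map_of_mem (AdicCompletion.evalₐ J 1) hy
  have h2 : (Ideal.span (Set.range f)).map (AdicCompletion.evalₐ J 1) =
      (Ideal.span (Set.range g)).map (Ideal.Quotient.mk (J ^ 1)) := by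
    rw [Ideal.map_span, Ideal.map_span, ← Set.range_comp, ← Set.range_comp]
    congr 2
    exact funext hg
  have h3 : AdicCompletion.evalₐ J 1 (Matrix.of fun i j => pd j (f i)).det =
      Ideal.Quotient.mk (J ^ 1) (Matrix.of fun i j => pderiv j (g i)).det := by
    rw [AlgHom.map_det, RingHom.map_det]
    congr 1
    ext i j
    exact evalₐ_one_pd hI j (pd j) (hpd_cont j) (hpd_ext j) (f i) (g i) (hg i)
  rw [h2, map_sub, map_mul, h3, ← hd, map_one, ← map_mul, ← map_one (Ideal.Quotient.mk _),
    ← map_sub, ← Ideal.mem_comap,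
    Ideal.comap_map_of_surjective' _ Ideal.Quotient.mk_surjective, Ideal.mk_ker, pow_one] at h1
  exact ⟨d, h1⟩

theorem AlgHom.exists_ringEquiv_quotient {A R S : Type*} [CommRing A] [CommRing R] [CommRing S]
    [Algebra A R] [Algebra A S] (φ : R →ₐ[A] S) (hφ : Function.Surjective φ) {K : Ideal R}
    (hK : RingHom.ker φ = K) :
    ∃ e : S ≃+* R ⧸ K, ∀ a, e (algebraMap A S a) = Ideal.Quotient.mk K (algebraMap A R a) := by
  subst hK
  refine ⟨(Ideal.quotientKerAlgEquivOfSurjective hφ).symm.toRingEquiv, fun a => ?_⟩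
  exact (Ideal.quotientKerAlgEquivOfSurjective hφ).symm.commutes a

/-- **Lemma on étale algebraization.** Let `A` be a noetherian ring, `I`-adically complete.
Let `f₁,…,f_m ∈ A⟨T₁,…,T_m⟩` and `B = A⟨T₁,…,T_m⟩/(f₁,…,f_m)`. Let `∂/∂Tⱼ` denote the
(unique) continuous extensions of the partial derivative operators to `A⟨T₁,…,T_m⟩`. If the
image in `B` of `Δ = det (∂fᵢ/∂Tⱼ)` is invertible, then there exists an étale `A`-algebra
whose `I`-adic completion is isomorphic to `B` as an `A`-algebra. -/
theorem statement0 {A : Type u} [CommRing A] [IsNoetherianRing A] (I : Ideal A)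
    [IsAdicComplete I A] (m : ℕ)
    (pd : Fin m → RestrictedPowerSeries A I m → RestrictedPowerSeries A I m)
    (hpd_cont : ∀ j : Fin m,
      Continuous[RestrictedPowerSeries.topology A I m, RestrictedPowerSeries.topology A I m]
        (pd j))
    (hpd_ext : ∀ (j : Fin m) (p : MvPolynomial (Fin m) A),
      pd j (RestrictedPowerSeries.of A I m p) = RestrictedPowerSeries.of A I m (pderiv j p))
    (f : Fin m → RestrictedPowerSeries A I m)
    (hΔ : IsUnit (Ideal.Quotient.mk (Ideal.span (Set.range f))
      (Matrix.det (Matrix.of fun i j : Fin m => pd j (f i))))) :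
    ∃ (C : Type u) (_ : CommRing C) (_ : Algebra A C),
      Algebra.Etale A C ∧
      ∃ e : AdicCompletion (I.map (algebraMap A C)) C ≃+*
            (RestrictedPowerSeries A I m ⧸ Ideal.span (Set.range f)),
        ∀ a : A,
          e (algebraMap C (AdicCompletion (I.map (algebraMap A C)) C) (algebraMap A C a)) =
            Ideal.Quotient.mk _ (RestrictedPowerSeries.of A I m (MvPolynomial.C a)) := by
  have hI : I.FG := IsNoetherian.noetherian I
  set J := I.map (algebraMap A (MvPolynomial (Fin m) A))
  choose p hp using fun n i => Ideal.Quotient.mk_surjective (AdicCompletion.evalₐ J n (f i))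
  obtain ⟨d, hd⟩ := RestrictedPowerSeries.exists_det_mul_sub_one_mem hI m pd hpd_cont hpd_ext f hΔ
    (p 1) fun i => (hp 1 i).symm
  obtain ⟨C, _, _, π, hC, hπ, hπs, hπk⟩ :=
    MvPolynomial.exists_etale_of_det_mul_sub_one_mem I (p 1) d hd
  set 𝔠 := I.map (algebraMap A C)
  have hπ' (q) : aeval (fun i => π (X i)) q = π q := (DFunLike.congr_fun (aeval_unique π) q).symm
  have hpJ (n i) : p (n + 1) i - p n i ∈ J ^ n :=
    AdicCompletion.mk_sub_mem_pow (f i) n.le_succ (hp n i).symm (hp (n + 1) i).symm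
  obtain ⟨t, ht0, ht, htp⟩ := exists_newton_seq I p hpJ (fun i => π (X i))
    (fun i => by rw [hπ', hπ]) (π d) (by
      rw [hπ', ← map_mul, ← map_one π, ← map_sub]
      have : Ideal.span (Set.range (p 1)) ⊔ J ≤ 𝔠.comap π := by
        refine sup_le (Ideal.span_le.mpr ?_) fun x hx => ?_
        · rintro _ ⟨i, rfl⟩
          simp [hπ]
        · have := AlgHom.apply_mem_map_pow π I (n := 1) (by rwa [pow_one])
          rwa [pow_one] at this
      exact this hd)
  obtain ⟨Φ, hΦ⟩ := exists_algHom_adicCompletion I t ht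
  have hΦπ (x q) (h : AdicCompletion.evalₐ J 1 x = Ideal.Quotient.mk _ q) :
      AdicCompletion.evalₐ 𝔠 1 (Φ x) = Ideal.Quotient.mk _ (π q) := by
    rw [hΦ 1 x q h, ← hπ' q]
    exact mk_aeval_eq_mk_aeval (fun j => by simpa using ht0 1 j) q
  have : IsNoetherianRing C := Algebra.FiniteType.isNoetherianRing A C
  obtain ⟨hs, hk⟩ := AdicCompletion.surjective_and_ker_eq_span hI π Φ hΦπ (fun i => (hp 1 i).symm)
    (fun i => AdicCompletion.ext_evalₐ fun n => by
      rw [hΦ n (f i) (p n i) (hp n i).symm, map_zero, Ideal.Quotient.eq_zero_iff_mem]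
      simpa using sub_mem (Ideal.pow_le_pow_right n.le_succ (htp n i))
        (AlgHom.apply_mem_map_pow (aeval (t n)) I (hpJ n i))) hπs hπk
  obtain ⟨e, he⟩ := Φ.exists_ringEquiv_quotient hs hk
  refine ⟨C, inferInstance, inferInstance, hC, e, fun a => ?_⟩
  rw [← IsScalarTower.algebraMap_apply A C, he, IsScalarTower.algebraMap_apply A
    (MvPolynomial (Fin m) A)]
  rfl
end

section
/- Let A be a noetherian ring, I an ideal of A, and assume A is I-adically complete. Let A⟨T₁,…,T_m⟩ denote the I-adic completion of the polynomial ring A[T₁,…,T_m]. Let g₁,…,g_m ∈ A[T₁,…,T_m], put B′ = A⟨T₁,…,T_m⟩/(g₁,…,g_m), and let Δ′ = det(∂gᵢ/∂Tⱼ) be the Jacobian determinant. Assume the image of Δ′ in B′ is invertible. Then the A-algebra C = A[T₁,…,T_m,T_{m+1}]/(g₁,…,g_m, T_{m+1}·Δ′ − 1) is étale over A, and the I-adic completion of C is isomorphic to B′ as an A-algebra. -/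
open MvPolynomial

/-- The Jacobian determinant `det (∂gᵢ/∂Tⱼ)` of a family of `m` polynomials in `m` variables. -/
noncomputable abbrev jacobianDet {A : Type*} [CommRing A] {m : ℕ}
    (g : Fin m → MvPolynomial (Fin m) A) : MvPolynomial (Fin m) A :=
  Matrix.det (Matrix.of fun i j : Fin m => pderiv j (g i))

/-- The `A`-algebra `C = A[T₁,…,T_{m+1}]/(g₁,…,g_m, T_{m+1}·Δ′ − 1)`, where
`Δ′ = det (∂gᵢ/∂Tⱼ)`. -/
noncomputable abbrev standardEtaleAlgebra (A : Type u) [CommRing A] {m : ℕ}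
    (g : Fin m → MvPolynomial (Fin m) A) : Type u :=
  MvPolynomial (Fin (m + 1)) A ⧸
    Ideal.span
      ((Set.range fun i => rename (Fin.castSucc : Fin m → Fin (m + 1)) (g i)) ∪
        {X (Fin.last m) * rename (Fin.castSucc : Fin m → Fin (m + 1)) (jacobianDet g) - 1})

theorem IsAdicComplete.of_linearEquiv {R M N : Type*} [CommRing R] [AddCommGroup M] [Module R M]
    [AddCommGroup N] [Module R N] (I : Ideal R) (e : M ≃ₗ[R] N) [IsAdicComplete I M] :
    IsAdicComplete I N := by
  rw [← AdicCompletion.of_bijective_iff]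
  have h := (AdicCompletion.of_bijective_iff (I := I) (M := M)).mpr inferInstance
  have key : (AdicCompletion.of I N : N → _) =
      (AdicCompletion.congr I e) ∘ (AdicCompletion.of I M) ∘ e.symm := by
    ext x n
    simp
  rw [key]
  exact (AdicCompletion.congr I e).bijective.comp (h.comp e.symm.bijective)

/-- Over a noetherian ring `R`, the quotient of the `J`-adic completion of `R` by an ideal extended
from `R` is `J`-adically complete. -/
theorem isAdicComplete_adicCompletion_quotient_map {R : Type*} [CommRing R] [IsNoetherianRing R]
    (J K : Ideal R) :
    IsAdicComplete J (AdicCompletion J R ⧸ K.map (algebraMap R (AdicCompletion J R))) := by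
  have := AdicCompletion.isAdicComplete (M := R ⧸ K) (I := J) (IsNoetherian.noetherian J)
  refine IsAdicComplete.of_linearEquiv J (M := AdicCompletion J (R ⧸ K)) ?_
  exact ((AdicCompletion.ofTensorProductEquivOfFiniteNoetherian J
    (R ⧸ K)).symm.restrictScalars R).trans
    ((Algebra.TensorProduct.quotIdealMapEquivTensorQuot
      (AdicCompletion J R) K).symm.toLinearEquiv.restrictScalars R)

/-- A ring homomorphism which is continuous for the adic topologies extends to the completion of
its source whenever its target is complete. -/
theorem exists_ringHom_adicCompletion_comp_eq {R S : Type*} [CommRing R] [CommRing S]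
    {J : Ideal R} {L : Ideal S} [IsAdicComplete L S] (φ : R →+* S) (h : J.map φ ≤ L) :
    ∃ F : AdicCompletion J R →+* S, F.comp (algebraMap R (AdicCompletion J R)) = φ := by
  have hn (n : ℕ) (a : R) (ha : a ∈ J ^ n) : ((Ideal.Quotient.mk (L ^ n)).comp φ) a = 0 := by
    rw [RingHom.comp_apply, Ideal.Quotient.eq_zero_iff_mem]
    refine Ideal.pow_right_mono h n ?_
    rw [← Ideal.map_pow]
    exact Ideal.mem_map_of_mem φ ha
  let f (n : ℕ) : AdicCompletion J R →+* S ⧸ L ^ n :=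
    (Ideal.Quotient.lift (J ^ n) ((Ideal.Quotient.mk (L ^ n)).comp φ) (hn n)).comp
      (AdicCompletion.evalₐ J n : AdicCompletion J R →+* R ⧸ J ^ n)
  have hf {k l : ℕ} (hle : k ≤ l) : (Ideal.Quotient.factorPow L hle).comp (f l) = f k := by
    ext x
    induction x using AdicCompletion.induction_on with
    | _ x =>
      simp only [f, RingHom.comp_apply, RingHom.coe_coe, AdicCompletion.evalₐ_mk,
        Ideal.Quotient.lift_mk]
      exact congrArg (Ideal.Quotient.lift (J ^ k) ((Ideal.Quotient.mk (L ^ k)).comp φ) (hn k))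
        (AdicCompletion.Ideal.mk_eq_mk J hle x)
  refine ⟨IsAdicComplete.liftRingHom L f hf, ?_⟩
  refine RingHom.coe_inj (IsHausdorff.funext' L fun n x ↦ ?_)
  rw [RingHom.comp_apply, IsAdicComplete.mk_liftRingHom]
  simp [f, AdicCompletion.algebraMap_apply]

/-- Ring homomorphisms out of an adic completion into a Hausdorff ring are determined by their
values on the original ring, provided they are continuous. -/
theorem AdicCompletion.ringHom_ext_of_isHausdorff {R S : Type*} [CommRing R] [CommRing S]
    {J : Ideal R} (hJ : J.FG) {L : Ideal S} [IsHausdorff L S] {f g : AdicCompletion J R →+* S}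
    (hfg : f.comp (algebraMap R (AdicCompletion J R)) = g.comp (algebraMap R (AdicCompletion J R)))
    (h : J.map (f.comp (algebraMap R (AdicCompletion J R))) ≤ L) : f = g := by
  have hmem (f : AdicCompletion J R →+* S)
      (h : J.map (f.comp (algebraMap R (AdicCompletion J R))) ≤ L) (n : ℕ)
      (x : AdicCompletion J R) (hx : x ∈ (J ^ n • ⊤ : Submodule R (AdicCompletion J R))) :
      f x ∈ L ^ n := by
    induction hx using Submodule.smul_induction_on' with
    | smul r hr y _ =>
      rw [Algebra.smul_def, map_mul]
      refine Ideal.mul_mem_right _ _ (Ideal.pow_right_mono h n ?_)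
      rw [← Ideal.map_pow]
      exact Ideal.mem_map_of_mem (f.comp (algebraMap R (AdicCompletion J R))) hr
    | add x _ y _ hx hy => rw [map_add]; exact add_mem hx hy
  refine RingHom.coe_inj (IsHausdorff.funext' L fun n x ↦ ?_)
  obtain ⟨r, hr⟩ := Submodule.Quotient.mk_surjective _ (AdicCompletion.eval J R n x)
  have hx : x - algebraMap R (AdicCompletion J R) r ∈
      (J ^ n • ⊤ : Submodule R (AdicCompletion J R)) := by
    rw [AdicCompletion.pow_smul_top_eq_ker_eval hJ, LinearMap.mem_ker, map_sub,
      ← hr, sub_eq_zero]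
    rfl
  have hf := hmem f h n _ hx
  have hg := hmem g (hfg ▸ h) n _ hx
  rw [Ideal.Quotient.eq]
  have hr := RingHom.congr_fun hfg r
  simp only [RingHom.comp_apply] at hr
  rw [map_sub] at hf hg
  rw [← hr] at hg
  simpa using sub_mem hf hg

theorem standardEtaleAlgebra_etale {A : Type u} [CommRing A] {m : ℕ}
    (g : Fin m → MvPolynomial (Fin m) A) : Algebra.Etale A (standardEtaleAlgebra A g) := by
  let v : Fin (m + 1) → MvPolynomial (Fin (m + 1)) A :=
    Fin.lastCases (X (Fin.last m) * rename Fin.castSucc (jacobianDet g) - 1)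
      fun i ↦ rename Fin.castSucc (g i)
  have hlast : v (Fin.last m) = X (Fin.last m) * rename Fin.castSucc (jacobianDet g) - 1 := by
    simp [v]
  have hcast (i : Fin m) : v i.castSucc = rename Fin.castSucc (g i) := by simp [v]
  have hv : Set.range v = (Set.range fun i => rename (Fin.castSucc : Fin m → Fin (m + 1)) (g i)) ∪
      {X (Fin.last m) * rename (Fin.castSucc : Fin m → Fin (m + 1)) (jacobianDet g) - 1} := by
    ext p
    simp [Fin.exists_fin_succ', hlast, hcast, or_comm, eq_comm]
  have hpd (p : MvPolynomial (Fin m) A) :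
      pderiv (Fin.last m) (rename (Fin.castSucc : Fin m → Fin (m + 1)) p) = 0 := by
    apply pderiv_eq_zero_of_notMem_vars
    intro h
    obtain ⟨i, -, hi⟩ := Finset.mem_image.mp (vars_rename _ _ h)
    exact Fin.castSucc_ne_last i hi
  let P : Algebra.PreSubmersivePresentation A
      (MvPolynomial (Fin (m + 1)) A ⧸ Ideal.span (Set.range v)) (Fin (m + 1)) (Fin (m + 1)) :=
    .naive id Function.injective_id
  have hdet : P.jacobiMatrix.det = rename (Fin.castSucc : Fin m → Fin (m + 1)) (jacobianDet g) *
      rename (Fin.castSucc : Fin m → Fin (m + 1)) (jacobianDet g) := by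
    rw [Matrix.det_succ_row _ (Fin.last m), Fin.sum_univ_castSucc]
    have h0 (j : Fin m) : P.jacobiMatrix (Fin.last m) j.castSucc = 0 := by
      rw [Algebra.PreSubmersivePresentation.jacobiMatrix_naive, hcast]
      exact hpd _
    have h1 : P.jacobiMatrix (Fin.last m) (Fin.last m) =
        rename (Fin.castSucc : Fin m → Fin (m + 1)) (jacobianDet g) := by
      rw [Algebra.PreSubmersivePresentation.jacobiMatrix_naive, hlast]
      simp [Derivation.leibniz, hpd]
    have h2 : (P.jacobiMatrix.submatrix (Fin.last m).succAbove (Fin.last m).succAbove).det =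
        rename (Fin.castSucc : Fin m → Fin (m + 1)) (jacobianDet g) := by
      rw [jacobianDet, AlgHom.map_det, ← Matrix.det_transpose]
      congr 1
      ext1 i j
      simp only [Matrix.transpose_apply, Matrix.submatrix_apply, Fin.succAbove_last]
      rw [Algebra.PreSubmersivePresentation.jacobiMatrix_naive, hcast]
      exact pderiv_rename (Fin.castSucc_injective m) _ _
    rw [h1, h2]
    simp [h0]
  have hunit : IsUnit (Ideal.Quotient.mk (Ideal.span (Set.range v))
      (rename (Fin.castSucc : Fin m → Fin (m + 1)) (jacobianDet g))) := by
    refine IsUnit.of_mul_eq_one (Ideal.Quotient.mk _ (X (Fin.last m))) ?_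
    rw [← map_mul, ← map_one (Ideal.Quotient.mk _), Ideal.Quotient.eq, mul_comm, ← hlast]
    exact Ideal.subset_span ⟨_, rfl⟩
  let Q : Algebra.SubmersivePresentation A
      (MvPolynomial (Fin (m + 1)) A ⧸ Ideal.span (Set.range v)) (Fin (m + 1)) (Fin (m + 1)) :=
    { toPreSubmersivePresentation := P
      jacobian_isUnit := by
        rw [Algebra.PreSubmersivePresentation.jacobian_eq_jacobiMatrix_det, hdet, map_mul]
        exact hunit.mul hunit }
  have hQ : Algebra.IsStandardSmoothOfRelativeDimension 0 A
      (MvPolynomial (Fin (m + 1)) A ⧸ Ideal.span (Set.range v)) :=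
    Q.isStandardSmoothOfRelativeDimension (by simp [Algebra.Presentation.dimension])
  exact .of_equiv (Ideal.quotientEquivAlgOfEq A (congrArg Ideal.span hv))

/-- If the Jacobian determinant `Δ′ = det(∂gᵢ/∂Tⱼ)` of `g₁,…,g_m ∈ A[T₁,…,T_m]` is invertible
in `B′ = A⟨T₁,…,T_m⟩/(g₁,…,g_m)`, then `C = A[T₁,…,T_{m+1}]/(g₁,…,g_m, T_{m+1}·Δ′ − 1)` is an
étale `A`-algebra whose `I`-adic completion is isomorphic to `B′` as an `A`-algebra. -/
theorem statement2 {A : Type u} [CommRing A] [IsNoetherianRing A] (I : Ideal A)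
    [IsAdicComplete I A] (m : ℕ) (g : Fin m → MvPolynomial (Fin m) A)
    (hΔ : IsUnit
      (Ideal.Quotient.mk (Ideal.span (Set.range fun i => RestrictedPowerSeries.of A I m (g i)))
        (RestrictedPowerSeries.of A I m (jacobianDet g)))) :
    Algebra.Etale A (standardEtaleAlgebra A g) ∧
    ∃ e : AdicCompletion (I.map (algebraMap A (standardEtaleAlgebra A g)))
            (standardEtaleAlgebra A g) ≃+*
          (RestrictedPowerSeries A I m ⧸
            Ideal.span (Set.range fun i => RestrictedPowerSeries.of A I m (g i))),
      ∀ a : A,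
        e (algebraMap (standardEtaleAlgebra A g) _ (algebraMap A (standardEtaleAlgebra A g) a)) =
          Ideal.Quotient.mk _ (RestrictedPowerSeries.of A I m (MvPolynomial.C a)) := by
  refine ⟨standardEtaleAlgebra_etale g, ?_⟩
  let of : MvPolynomial (Fin m) A →+* RestrictedPowerSeries A I m := RestrictedPowerSeries.of A I m
  let J : Ideal (MvPolynomial (Fin m) A) := I.map (algebraMap A (MvPolynomial (Fin m) A))
  let K := Ideal.span (Set.range fun i => RestrictedPowerSeries.of A I m (g i))
  let IC := I.map (algebraMap A (standardEtaleAlgebra A g))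
  let π : MvPolynomial (Fin m) A →+* RestrictedPowerSeries A I m ⧸ K :=
    (Ideal.Quotient.mk K).comp of
  let ι : standardEtaleAlgebra A g →+* AdicCompletion IC (standardEtaleAlgebra A g) :=
    algebraMap _ _
  let ρ : MvPolynomial (Fin m) A →+* standardEtaleAlgebra A g :=
    (Ideal.Quotient.mk _).comp (rename (Fin.castSucc : Fin m → Fin (m + 1))).toRingHom
  have hK : (Ideal.span (Set.range g)).map of = K := by
    rw [Ideal.map_span, ← Set.range_comp]; rfl
  have hπg (i : Fin m) : π (g i) = 0 :=
    Ideal.Quotient.eq_zero_iff_mem.mpr (Ideal.subset_span ⟨i, rfl⟩)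
  have hρg (i : Fin m) : ρ (g i) = 0 :=
    Ideal.Quotient.eq_zero_iff_mem.mpr (Ideal.subset_span (.inl ⟨i, rfl⟩))
  let t : standardEtaleAlgebra A g := Ideal.Quotient.mk _ (X (Fin.last m))
  have ht : t * ρ (jacobianDet g) = 1 := by
    change Ideal.Quotient.mk _ _ * Ideal.Quotient.mk _ _ = _
    rw [← map_mul, ← map_one (Ideal.Quotient.mk _), Ideal.Quotient.eq]
    exact Ideal.subset_span (.inr rfl)
  have hB : IsAdicComplete (J.map π) (RestrictedPowerSeries A I m ⧸ K) := by
    have h := isAdicComplete_adicCompletion_quotient_map J (Ideal.span (Set.range g))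
    change IsAdicComplete J (_ ⧸ (Ideal.span (Set.range g)).map of) at h
    rw [hK] at h
    exact (IsAdicComplete.map_algebraMap_iff ..).mpr h
  have hC : IsAdicComplete (IC.map ι) (AdicCompletion IC (standardEtaleAlgebra A g)) :=
    (IsAdicComplete.map_algebraMap_iff ..).mpr
      (AdicCompletion.isAdicComplete (IsNoetherian.noetherian IC))
  have hJρ : J.map ρ = IC := by
    rw [Ideal.map_map]
    exact congrArg I.map (RingHom.ext fun a ↦ congrArg (Ideal.Quotient.mk _) (rename_C _ a))
  obtain ⟨u, hu⟩ := hΔ.exists_left_inv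
  change u * π (jacobianDet g) = 1 at hu
  let φ₀ : MvPolynomial (Fin (m + 1)) A →+* RestrictedPowerSeries A I m ⧸ K :=
    eval₂Hom (π.comp C) (Fin.lastCases u fun i ↦ π (X i))
  have hφ₀ (p : MvPolynomial (Fin m) A) : φ₀ (rename Fin.castSucc p) = π p := by
    have : φ₀.comp (rename (Fin.castSucc : Fin m → Fin (m + 1))).toRingHom = π := by
      ext <;> simp [φ₀]
    exact RingHom.congr_fun this p
  let φ : standardEtaleAlgebra A g →+* RestrictedPowerSeries A I m ⧸ K :=
    Ideal.Quotient.lift _ φ₀ fun a ha ↦ by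
      rw [← RingHom.mem_ker]
      refine Ideal.span_le.mpr ?_ ha
      rintro _ (⟨i, rfl⟩ | rfl)
      · exact (hφ₀ _).trans (hπg i)
      · rw [SetLike.mem_coe, RingHom.mem_ker, map_sub, map_mul, hφ₀, map_one]
        simp [φ₀, hu]
  have hφρ : φ.comp ρ = π := RingHom.ext hφ₀
  have hφt : φ t = u := by
    change φ₀ (X (Fin.last m)) = u
    simp [φ₀]
  have hICφ : IC.map φ = J.map π := by rw [← hJρ, Ideal.map_map, hφρ]
  obtain ⟨F, hF⟩ := exists_ringHom_adicCompletion_comp_eq (J := IC) φ hICφ.le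
  have hJι : J.map (ι.comp ρ) = IC.map ι := by rw [← Ideal.map_map, hJρ]
  obtain ⟨G₀, hG₀⟩ := exists_ringHom_adicCompletion_comp_eq (J := J) (ι.comp ρ) hJι.le
  let G : RestrictedPowerSeries A I m ⧸ K →+* AdicCompletion IC (standardEtaleAlgebra A g) :=
    Ideal.Quotient.lift K G₀ fun a ha ↦ by
      rw [← RingHom.mem_ker]
      refine Ideal.span_le.mpr ?_ ha
      rintro _ ⟨i, rfl⟩
      refine (RingHom.congr_fun hG₀ (g i)).trans ?_
      rw [RingHom.comp_apply, hρg, map_zero]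
  have hGπ : G.comp π = ι.comp ρ := hG₀
  have hFG : F.comp G = RingHom.id _ := by
    apply Ideal.Quotient.ringHom_ext
    have h : ((F.comp G).comp (Ideal.Quotient.mk K)).comp of = π := by
      rw [RingHom.comp_assoc, RingHom.comp_assoc]
      change F.comp (G.comp π) = π
      rw [hGπ, ← RingHom.comp_assoc, hF, hφρ]
    exact AdicCompletion.ringHom_ext_of_isHausdorff (J := J) (IsNoetherian.noetherian J)
      (L := J.map π) h (congrArg J.map h).le
  have hGφ : G.comp φ = ι := by
    have h : (G.comp φ).comp ρ = ι.comp ρ := by rw [RingHom.comp_assoc, hφρ, hGπ]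
    apply Ideal.Quotient.ringHom_ext
    refine MvPolynomial.ringHom_ext (fun a ↦ ?_) fun i ↦ ?_
    · simpa [ρ] using RingHom.congr_fun h (C a)
    · refine Fin.lastCases ?_ (fun i ↦ ?_) i
      · change (G.comp φ) t = ι t
        have h1 : (G.comp φ) t * ι (ρ (jacobianDet g)) = 1 := by
          rw [← RingHom.comp_apply ι ρ, ← h, RingHom.comp_apply _ ρ, ← map_mul, ht, map_one]
        have h2 : ι t * ι (ρ (jacobianDet g)) = 1 := by rw [← map_mul, ht, map_one]
        exact left_inv_eq_right_inv h1 (mul_comm (ι t) _ ▸ h2)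
      · simpa [ρ] using RingHom.congr_fun h (X i)
  have hGF : G.comp F = RingHom.id _ := by
    have h : (G.comp F).comp ι = ι := by rw [RingHom.comp_assoc, hF, hGφ]
    exact AdicCompletion.ringHom_ext_of_isHausdorff (J := IC) (IsNoetherian.noetherian IC)
      (L := IC.map ι) h (congrArg IC.map h).le
  refine ⟨RingEquiv.ofRingHom F G hFG hGF, fun a ↦ ?_⟩
  refine (RingHom.congr_fun hF _).trans ?_
  change φ₀ (C a) = π (C a)
  simp [φ₀]
end

section
/- Let A be a noetherian ring and I an ideal of A such that A is I-adically complete. Let B be a noetherian A-algebra that is I·B-adically complete, and assume that for every n ≥ 0 the A/I^{n+1}-algebra B/I^{n+1}B is flat. Then B is flat as an A-module. -/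
/-- Over a noetherian ring, a submodule of a finite free module is closed for the adic topology of
an ideal contained in the Jacobson radical. -/
theorem Submodule.mem_of_forall_exists_sub_mem_pow {R ι : Type*} [CommRing R] [IsNoetherianRing R]
    [Finite ι] {J : Ideal R} (hJ : J ≤ Ideal.jacobson ⊥) (N : Submodule R (ι → R)) {x : ι → R}
    (h : ∀ n, ∃ z ∈ N, ∀ i, x i - z i ∈ J ^ n) : x ∈ N := by
  classical
  have := Fintype.ofFinite ι
  rw [← Submodule.Quotient.mk_eq_zero, ← Submodule.mem_bot R,
    ← J.iInf_pow_smul_eq_bot_of_le_jacobson hJ, Submodule.mem_iInf]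
  intro n
  obtain ⟨z, hz, hxz⟩ := h n
  have hmk : N.mkQ x = N.mkQ (x - z) := by
    rw [map_sub, Submodule.mkQ_apply N z, (Submodule.Quotient.mk_eq_zero N).mpr hz, sub_zero]
  have hsum : N.mkQ (x - z) = ∑ i, (x i - z i) • N.mkQ (Pi.single i 1) := by
    conv_lhs => rw [pi_eq_sum_univ' (x - z)]
    simp only [map_sum, map_smul, Pi.sub_apply]
  change N.mkQ x ∈ _
  rw [hmk, hsum]
  exact Submodule.sum_mem _ fun i _ ↦ Submodule.smul_mem_smul (hxz i) trivial

/-- A form of the Artin-Rees lemma: an approximate syzygy of `f` is close to a syzygy of `f`. -/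
theorem Ideal.exists_pow_syzygy_approx {R ι : Type*} [CommRing R] [IsNoetherianRing R]
    [Fintype ι] (I : Ideal R) (f : ι → R) (n : ℕ) :
    ∃ m, ∀ a : ι → R, ∑ i, f i * a i ∈ I ^ m →
      ∃ c : ι → R, (∀ i, c i ∈ I ^ n) ∧ ∑ i, f i * (a i - c i) = 0 := by
  obtain ⟨k, hk⟩ := I.exists_pow_inf_eq_pow_smul (Submodule.span R (Set.range f))
  refine ⟨n + k, fun a ha ↦ ?_⟩
  have hmem : ∑ i, f i * a i ∈ I ^ (n + k) • (⊤ : Submodule R R) ⊓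
      Submodule.span R (Set.range f) := by
    refine ⟨by simpa using ha, Submodule.sum_mem _ fun i _ ↦ ?_⟩
    rw [mul_comm]
    exact Submodule.smul_mem _ _ (Submodule.subset_span ⟨i, rfl⟩)
  rw [hk _ (by omega), Nat.add_sub_cancel] at hmem
  obtain ⟨c, hc, hsum⟩ := (Submodule.mem_ideal_smul_span_iff_exists_sum _ _ _).mp
    (Submodule.smul_mono le_rfl inf_le_right hmem)
  refine ⟨c, hc, ?_⟩
  rw [Finsupp.sum_fintype _ _ fun i ↦ zero_smul R (f i)] at hsum
  rw [Finset.sum_congr rfl fun i _ ↦ mul_sub _ _ _, Finset.sum_sub_distrib, ← hsum, sub_eq_zero]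
  exact Finset.sum_congr rfl fun i _ ↦ mul_comm _ _

/-- If `B / JB` is flat over `A / J`, then every relation in `B` with coefficients in `A` is trivial
modulo `J`. -/
theorem Module.Flat.exists_isTrivialRelation_mod {A B ι : Type*} [CommRing A] [CommRing B]
    [Algebra A B] [Fintype ι] (J : Ideal A)
    (hflat :
      letI : Algebra (A ⧸ J) (B ⧸ J.map (algebraMap A B)) :=
        Ideal.Quotient.algebraQuotientOfLEComap Ideal.le_comap_map
      Module.Flat (A ⧸ J) (B ⧸ J.map (algebraMap A B)))
    {f : ι → A} {x : ι → B} (h : ∑ i, f i • x i = 0) :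
    ∃ (k : ℕ) (a : ι → Fin k → A) (y : Fin k → B),
      (∀ i, x i - ∑ j, a i j • y j ∈ J.map (algebraMap A B)) ∧ ∀ j, ∑ i, f i * a i j ∈ J := by
  let _ : Algebra (A ⧸ J) (B ⧸ J.map (algebraMap A B)) :=
    Ideal.Quotient.algebraQuotientOfLEComap Ideal.le_comap_map
  have hsmul (a : A) (b : B) : Ideal.Quotient.mk J a • Ideal.Quotient.mk (J.map (algebraMap A B)) b
      = Ideal.Quotient.mk (J.map (algebraMap A B)) (a • b) := rfl
  obtain ⟨k, a, y, hx, hf⟩ := hflat.isTrivialRelation_of_sum_smul_eq_zero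
    (f := fun i ↦ Ideal.Quotient.mk J (f i))
    (x := fun i ↦ Ideal.Quotient.mk (J.map (algebraMap A B)) (x i))
    (by simp only [hsmul, ← map_sum, h, map_zero])
  choose a' ha' using fun i j ↦ Ideal.Quotient.mk_surjective (a i j)
  choose y' hy' using fun j ↦ Ideal.Quotient.mk_surjective (y j)
  refine ⟨k, a', y', fun i ↦ ?_, fun j ↦ ?_⟩
  · rw [← Ideal.Quotient.eq]
    refine (hx i).trans ?_
    rw [map_sum]
    simp only [← ha', ← hy', hsmul]
  · rw [← Ideal.Quotient.eq_zero_iff_mem, map_sum, ← hf j]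
    simp only [← ha', map_mul]

/-- Local criterion: if `A` is noetherian and `I`-adically complete, `B` is a noetherian
`A`-algebra that is `I·B`-adically complete, and `B/I^{n+1}B` is flat over `A/I^{n+1}` for
every `n ≥ 0`, then `B` is flat over `A`. -/
theorem statement3 {A B : Type*} [CommRing A] [IsNoetherianRing A] (I : Ideal A)
    [IsAdicComplete I A] [CommRing B] [IsNoetherianRing B] [Algebra A B]
    [IsAdicComplete (I.map (algebraMap A B)) B]
    (hflat : ∀ n : ℕ,
      letI : Algebra (A ⧸ I ^ (n + 1)) (B ⧸ (I ^ (n + 1)).map (algebraMap A B)) :=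
        Ideal.Quotient.algebraQuotientOfLEComap Ideal.le_comap_map
      Module.Flat (A ⧸ I ^ (n + 1)) (B ⧸ (I ^ (n + 1)).map (algebraMap A B))) :
    Module.Flat A B := by
  refine Module.Flat.of_forall_isTrivialRelation fun {l f x} hfx ↦ ?_
  let S : Set (Fin l → B) := {v | ∃ a : Fin l → A, ∑ i, f i * a i = 0 ∧ v = algebraMap A B ∘ a}
  have hxS : x ∈ Submodule.span B S := by
    refine Submodule.mem_of_forall_exists_sub_mem_pow
      (IsAdicComplete.le_jacobson_bot (I.map (algebraMap A B))) _ fun n ↦ ?_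
    obtain ⟨m, hm⟩ := I.exists_pow_syzygy_approx f n
    obtain ⟨k, a, y, hx, hf⟩ := Module.Flat.exists_isTrivialRelation_mod _ (hflat (m + n)) hfx
    choose c hc hac using fun j ↦ hm (fun i ↦ a i j) (Ideal.pow_le_pow_right (by omega) (hf j))
    refine ⟨∑ j, y j • (algebraMap A B ∘ fun i ↦ a i j - c j i),
      Submodule.sum_mem _ fun j _ ↦ Submodule.smul_mem _ _ (Submodule.subset_span ⟨_, hac j, rfl⟩),
      fun i ↦ ?_⟩
    have hsplit : x i - (∑ j, y j • (algebraMap A B ∘ fun i ↦ a i j - c j i)) i =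
        (x i - ∑ j, a i j • y j) + ∑ j, y j * algebraMap A B (c j i) := by
      simp only [Finset.sum_apply, Pi.smul_apply, Function.comp_apply, map_sub, smul_eq_mul,
        mul_sub, Finset.sum_sub_distrib, Algebra.smul_def (A := B) (R := A)]
      simp only [mul_comm]
      ring
    rw [hsplit, ← Ideal.map_pow]
    exact Ideal.add_mem _ (Ideal.map_mono (Ideal.pow_le_pow_right (by omega)) (hx i))
      (Ideal.sum_mem _ fun j _ ↦ Ideal.mul_mem_left _ _ (Ideal.mem_map_of_mem _ (hc j i)))
  obtain ⟨k, y, v, rfl⟩ := Submodule.mem_span_set'.mp hxS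
  choose a ha hv using fun j ↦ (v j).2
  refine ⟨k, fun i j ↦ a j i, y, fun i ↦ ?_, ha⟩
  simp [hv, Algebra.smul_def, mul_comm]
end

section
/- Let A be a commutative ring, let I be an ideal of A generated by finitely many elements a₁,…,a_n, and equip A with the I-adic topology. Let Γ₀ be a linearly ordered commutative group with zero and let v : A → Γ₀ be a valuation such that v(x) ≤ 1 for all x ∈ A, and such that v is continuous, i.e. for every nonzero γ ∈ Γ₀ the set {x ∈ A : v(x) < γ} is open in the I-adic topology. Let ϖ ∈ A with v(ϖ) ≠ 0. Then there exists an integer k ≥ 1 such that v(aᵢ)^k ≤ v(ϖ) for every i = 1,…,n. -/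
open Topology

/-- If `v` is a continuous valuation (for the `I`-adic topology, `I = (a₁,…,aₙ)`) on a ring `A`
with `v ≤ 1` and `v ϖ ≠ 0`, then there is `k ≥ 1` with `v (aᵢ)^k ≤ v ϖ` for all `i`. -/
theorem statement4 {A : Type*} [CommRing A] {Γ₀ : Type*} [LinearOrderedCommGroupWithZero Γ₀]
    (n : ℕ) (a : Fin n → A) (I : Ideal A) (hI : I = Ideal.span (Set.range a))
    (v : Valuation A Γ₀) (hv1 : ∀ x : A, v x ≤ 1)
    (hcont : ∀ γ : Γ₀, γ ≠ 0 → IsOpen[I.adicTopology] {x : A | v x < γ})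
    (ϖ : A) (hϖ : v ϖ ≠ 0) :
    ∃ k : ℕ, 1 ≤ k ∧ ∀ i : Fin n, v (a i) ^ k ≤ v ϖ := by
  have hmem : {x : A | v x < v ϖ} ∈ @nhds A I.adicTopology 0 :=
    letI := I.adicTopology; (hcont _ hϖ).mem_nhds (by simpa using zero_lt_iff.mpr hϖ)
  obtain ⟨m, -, hm⟩ := I.hasBasis_nhds_zero_adic.mem_iff.mp hmem
  refine ⟨m + 1, by lia, fun i => ?_⟩
  have hai : a i ∈ I := hI ▸ Ideal.subset_span (Set.mem_range_self i)
  have hlt : v (a i ^ (m + 1)) < v ϖ :=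
    hm (Ideal.pow_le_pow_right m.le_succ (Ideal.pow_mem_pow hai _))
  exact (map_pow v (a i) (m + 1)).symm.trans_le hlt.le
end
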